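/- (Theorem 1, high-probability version.) Let (Ω, ℱ, P) be a probability space with a filtration (ℱ_t)_{t=1}^T, and let w_1,…,w_T : Ω → D and g_1,…,g_T : Ω → E be random variables such that for each t the variables w_1,…,w_t (hence x_t) are ℱ_t-measurable and g_1,…,g_{t−1} are ℱ_t-measurable. Suppose ℒ : E → ℝ is convex, that almost surely G_t = E[g_t | ℱ_t] ∈ ∂ℒ(x_t), that D has diameter at most B (so ‖u − v‖ ≤ B for all u, v ∈ D), and that ‖g_t‖ ≤ G almost surely for all t. Then for every x⋆ ∈ D and every δ ∈ (0, 1], with probability at least 1 − δ: α_{1:T}(ℒ(x_T) − ℒ(x⋆)) ≤ Σ_{t=1}^T α_t ⟨g_t, w_t − x⋆⟩ + 2BG √(Σ_{t=1}^T α_t² · log(2/δ)). -/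

import Mathlib

open MeasureTheory
open scoped RealInnerProductSpace

/-- Hoeffding's lemma in affine form: on `[-c, c]` the function `z ↦ exp (-l * z)` has an affine
majorant whose value at any point `y` is at most `exp (-l * y)` times the sub-Gaussian factor. -/
lemma exists_affine_majorant_exp {c : ℝ} (hc : 0 ≤ c) (l : ℝ) :
    ∃ a b : ℝ, (∀ z, |z| ≤ c → Real.exp (-l * z) ≤ a + b * z) ∧
      ∀ y, |y| ≤ c → Real.exp (l * y) * (a + b * y) ≤ Real.exp (c ^ 2 * l ^ 2 / 2) := by
  rcases hc.eq_or_lt with rfl | hc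
  · refine ⟨1, 0, fun z hz => ?_, fun y hy => ?_⟩
    · simp [abs_nonpos_iff.1 hz]
    · simp [abs_nonpos_iff.1 hy]
  set p := Real.exp (l * c)
  set q := Real.exp (-l * c)
  have affine : ∀ z, (p + q) / 2 + (q - p) / (2 * c) * z
      = (c - z) / (2 * c) * p + (c + z) / (2 * c) * q := fun z => by field_simp; ring
  refine ⟨(p + q) / 2, (q - p) / (2 * c), fun z hz => ?_, fun y hy => ?_⟩
  · rw [affine]
    obtain ⟨hz1, hz2⟩ := abs_le.1 hz
    have h := convexOn_exp.2 (Set.mem_univ (l * c)) (Set.mem_univ (-l * c))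
      (div_nonneg (by linarith) (by linarith) : 0 ≤ (c - z) / (2 * c))
      (div_nonneg (by linarith) (by linarith) : 0 ≤ (c + z) / (2 * c))
      (by field_simp; ring)
    have e : ((c - z) / (2 * c)) • (l * c) + ((c + z) / (2 * c)) • (-l * c) = -l * z := by
      simp only [smul_eq_mul]; field_simp; ring
    rw [e] at h
    simpa only [smul_eq_mul] using h
  · rw [affine]
    obtain ⟨hy1, hy2⟩ := abs_le.1 hy
    have h0 : 0 ≤ (c - y) / (2 * c) := div_nonneg (by linarith) (by linarith)
    have h1 : 0 ≤ (c + y) / (2 * c) := div_nonneg (by linarith) (by linarith)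
    have h01 : (c - y) / (2 * c) + (c + y) / (2 * c) = 1 := by field_simp; ring
    set ν : Measure ℝ := ENNReal.ofReal ((c - y) / (2 * c)) • Measure.dirac (-c)
      + ENNReal.ofReal ((c + y) / (2 * c)) • Measure.dirac c with hν
    have integral_ν : ∀ φ : ℝ → ℝ,
        ∫ z, φ z ∂ν = (c - y) / (2 * c) * φ (-c) + (c + y) / (2 * c) * φ c := by
      intro φ
      rw [hν, integral_add_measure
          ((integrable_dirac (by simp)).smul_measure ENNReal.ofReal_ne_top)
          ((integrable_dirac (by simp)).smul_measure ENNReal.ofReal_ne_top)]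
      simp [integral_smul_measure, ENNReal.toReal_ofReal, h0, h1]
    have : IsProbabilityMeasure ν :=
      ⟨by simp [hν, ← ENNReal.ofReal_add h0 h1, h01]⟩
    have mem_Icc : ∀ᵐ z ∂ν, id z ∈ Set.Icc (-c) c := by
      rw [hν, ae_add_measure_iff]
      constructor <;> apply Measure.ae_smul_measure <;>
        simp [ae_dirac_eq, hc.le]
    have mean : ∫ z, id z ∂ν = y := by
      rw [integral_ν]; simp only [id]; field_simp; ring
    have h := (ProbabilityTheory.hasSubgaussianMGF_of_mem_Icc aemeasurable_id mem_Icc).mgf_le (-l)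
    rw [ProbabilityTheory.mgf, integral_ν, mean] at h
    have e1 : Real.exp (-l * (id (-c) - y)) = Real.exp (l * y) * p := by
      rw [← Real.exp_add]; simp only [id]; ring_nf
    have e2 : Real.exp (-l * (id c - y)) = Real.exp (l * y) * q := by
      rw [← Real.exp_add]; simp only [id]; ring_nf
    have e3 : ((((‖c - -c‖₊ / 2) ^ 2 : NNReal)) : ℝ) = c ^ 2 := by
      simp only [NNReal.coe_pow, NNReal.coe_div, coe_nnnorm, Real.norm_eq_abs]
      rw [abs_of_nonneg (by linarith)]
      simp only [NNReal.coe_ofNat]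
      ring
    rw [e1, e2, e3, neg_sq] at h
    linarith

/-- Adding a bounded martingale difference `P[Z | m] - Z` to an `m`-measurable sub-Gaussian
variable increases the sub-Gaussian parameter by the square of the bound on `Z`. -/
lemma ProbabilityTheory.HasSubgaussianMGF.add_condExp_sub {Ω : Type*} {m m0 : MeasurableSpace Ω}
    {P : Measure Ω} [IsProbabilityMeasure P] (hm : m ≤ m0) {S Z : Ω → ℝ} {v c : NNReal}
    (hS : HasSubgaussianMGF S v P) (hSm : StronglyMeasurable[m] S)
    (hZ : AEStronglyMeasurable Z P) (hZc : ∀ᵐ ω ∂P, |Z ω| ≤ c) :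
    HasSubgaussianMGF (fun ω => S ω + ((P[Z | m]) ω - Z ω)) (v + c ^ 2) P := by
  have hZi : Integrable Z P := Integrable.of_bound hZ c hZc
  have hYc : ∀ᵐ ω ∂P, |(P[Z | m]) ω| ≤ c := ae_bdd_abs_condExp_of_ae_bdd_abs hZc
  have hYm : StronglyMeasurable[m] (P[Z | m]) := stronglyMeasurable_condExp
  have exp_int : ∀ l : ℝ,
      Integrable (fun ω => Real.exp (l * (S ω + ((P[Z | m]) ω - Z ω)))) P := by
    intro l
    have h : Integrable (fun ω => Real.exp (l * ((P[Z | m]) ω - Z ω))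
        * Real.exp (l * S ω)) P := by
      refine (hS.integrable_exp_mul l).bdd_mul (c := Real.exp (|l| * (c + c))) ?_ ?_
      · exact Real.continuous_exp.comp_aestronglyMeasurable
          (((hYm.mono hm).aestronglyMeasurable.sub hZ).const_mul l)
      · filter_upwards [hZc, hYc] with ω h1 h2
        rw [Real.norm_eq_abs, Real.abs_exp, Real.exp_le_exp]
        refine (le_abs_self _).trans ?_
        rw [abs_mul]
        gcongr
        exact (abs_sub _ _).trans (add_le_add h2 h1)
    refine h.congr (ae_of_all _ fun ω => ?_)
    simp only [← Real.exp_add]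
    ring_nf
  refine ⟨exp_int, fun l => ?_⟩
  obtain ⟨a, b, hab, hK⟩ := exists_affine_majorant_exp c.coe_nonneg l
  set V : Ω → ℝ := fun ω => Real.exp (l * (P[Z | m]) ω) * Real.exp (l * S ω) with hV
  have hVm : AEStronglyMeasurable[m] V P :=
    (Real.continuous_exp.comp_aestronglyMeasurable (hYm.aestronglyMeasurable.const_mul l)).mul
      (Real.continuous_exp.comp_aestronglyMeasurable (hSm.aestronglyMeasurable.const_mul l))
  have hVi : Integrable V P := by
    refine (hS.integrable_exp_mul l).bdd_mul (c := Real.exp (|l| * c))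
      (Real.continuous_exp.comp_aestronglyMeasurable
        ((hYm.mono hm).aestronglyMeasurable.const_mul l)) ?_
    filter_upwards [hYc] with ω h2
    rw [Real.norm_eq_abs, Real.abs_exp, Real.exp_le_exp]
    refine (le_abs_self _).trans ?_
    rw [abs_mul]
    gcongr
  have hVZ : Integrable (V * Z) P := hVi.mul_bdd (c := (c : ℝ)) hZ hZc
  have hVY : Integrable (V * P[Z | m]) P :=
    hVi.mul_bdd (c := (c : ℝ)) (hYm.mono hm).aestronglyMeasurable hYc
  have pull : ∫ ω, V ω * Z ω ∂P = ∫ ω, V ω * (P[Z | m]) ω ∂P := by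
    change ∫ ω, (V * Z) ω ∂P = _
    rw [← integral_condExp hm]
    exact integral_congr_ae (condExp_mul_of_aestronglyMeasurable_left hVm hVZ hZi)
  calc mgf (fun ω => S ω + ((P[Z | m]) ω - Z ω)) P l
      ≤ ∫ ω, (a * V ω + b * (V ω * Z ω)) ∂P := by
        refine integral_mono_ae (exp_int l) ((hVi.const_mul a).add (hVZ.const_mul b)) ?_
        filter_upwards [hZc] with ω hω
        have e : Real.exp (l * (S ω + ((P[Z | m]) ω - Z ω))) = V ω * Real.exp (-l * Z ω) := by
          simp only [hV, ← Real.exp_add]; ring_nf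
        have hVpos : 0 ≤ V ω := by positivity
        have := mul_le_mul_of_nonneg_left (hab _ hω) hVpos
        simp only [e]
        linarith
    _ = ∫ ω, (a * V ω + b * (V ω * (P[Z | m]) ω)) ∂P := by
        refine (integral_add (hVi.const_mul a) (hVZ.const_mul b)).trans
          (Eq.trans ?_ (integral_add (hVi.const_mul a) (hVY.const_mul b)).symm)
        simp only [integral_const_mul, Pi.mul_apply, pull]
    _ ≤ ∫ ω, Real.exp (c ^ 2 * l ^ 2 / 2) * Real.exp (l * S ω) ∂P := by
        refine integral_mono_ae ((hVi.const_mul a).add (hVY.const_mul b))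
          ((hS.integrable_exp_mul l).const_mul _) ?_
        filter_upwards [hYc] with ω hω
        have := mul_le_mul_of_nonneg_right (hK _ hω) (Real.exp_pos (l * S ω)).le
        simp only [hV]
        linarith
    _ = Real.exp (c ^ 2 * l ^ 2 / 2) * mgf S P l := integral_const_mul _ _
    _ ≤ Real.exp (c ^ 2 * l ^ 2 / 2) * Real.exp (v * l ^ 2 / 2) := by
        gcongr; exact hS.mgf_le l
    _ = Real.exp ((v + c ^ 2 : NNReal) * l ^ 2 / 2) := by
        rw [← Real.exp_add]; push_cast; ring_nf

/-- A sum of bounded martingale differences `P[Z t | ℱ t] - Z t` is sub-Gaussian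
(Azuma–Hoeffding, on an arbitrary probability space). -/
lemma hasSubgaussianMGF_sum_condExp_sub {Ω : Type*} {m0 : MeasurableSpace Ω} {P : Measure Ω}
    [IsProbabilityMeasure P] {ℱ : ℕ → MeasurableSpace Ω} (hmono : Monotone ℱ)
    (hle : ∀ t, ℱ t ≤ m0) {Z : ℕ → Ω → ℝ} {c : ℕ → NNReal} (n : ℕ)
    (hadapted : ∀ s t, 1 ≤ s → s < t → t ≤ n → StronglyMeasurable[ℱ t] (Z s))
    (hZ : ∀ t, 1 ≤ t → t ≤ n → AEStronglyMeasurable (Z t) P)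
    (hZc : ∀ t, 1 ≤ t → t ≤ n → ∀ᵐ ω ∂P, |Z t ω| ≤ c t) :
    ProbabilityTheory.HasSubgaussianMGF
      (fun ω => ∑ t ∈ Finset.Icc 1 n, ((P[Z t | ℱ t]) ω - Z t ω))
      (∑ t ∈ Finset.Icc 1 n, c t ^ 2) P := by
  induction n with
  | zero => simp
  | succ n ih =>
    have ih := ih (fun s t h1 h2 h3 => hadapted s t h1 h2 (by omega))
      (fun t h1 h2 => hZ t h1 (by omega)) (fun t h1 h2 => hZc t h1 (by omega))
    simp only [Finset.sum_Icc_succ_top (Nat.le_add_left 1 n)]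
    refine ih.add_condExp_sub (hle _) ?_ (hZ _ (by omega) le_rfl) (hZc _ (by omega) le_rfl)
    refine Finset.stronglyMeasurable_fun_sum _ fun t ht => ?_
    rw [Finset.mem_Icc] at ht
    exact (stronglyMeasurable_condExp.mono (hmono (by omega))).sub
      (hadapted t _ ht.1 (by omega) le_rfl)

/-- Deterministic anytime online-to-batch inequality: the weighted suboptimality of the averaged
iterate is at most the linearized regret measured with subgradients at the averages. -/
lemma sum_mul_sub_le_sum_mul_inner_of_subgradient {E : Type*} [NormedAddCommGroup E]
    [InnerProductSpace ℝ E] {f : E → ℝ} {α : ℕ → ℝ} {w x γ : ℕ → E} (n : ℕ)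
    (hα : ∀ t, 1 ≤ t → t ≤ n → 0 ≤ α t)
    (hx : ∀ t ≤ n, (∑ i ∈ Finset.Icc 1 t, α i) • x t = ∑ i ∈ Finset.Icc 1 t, α i • w i)
    (hγ : ∀ t, 1 ≤ t → t ≤ n → ∀ y, f y ≥ f (x t) + ⟪γ t, y - x t⟫) (u : E) :
    (∑ t ∈ Finset.Icc 1 n, α t) * (f (x n) - f u)
      ≤ ∑ t ∈ Finset.Icc 1 n, α t * ⟪γ t, w t - u⟫ := by
  induction n with
  | zero => simp
  | succ n ih =>
    have ih := ih (fun t h1 h2 => hα t h1 (by omega)) (fun t h => hx t (by omega))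
      (fun t h1 h2 => hγ t h1 (by omega))
    have hxn := hx n (by omega)
    have hxs := hx (n + 1) le_rfl
    have hA : 0 ≤ ∑ t ∈ Finset.Icc 1 n, α t := Finset.sum_nonneg fun t ht => by
      rw [Finset.mem_Icc] at ht
      exact hα t ht.1 (by omega)
    have ha := hα (n + 1) (by omega) le_rfl
    simp only [Finset.sum_Icc_succ_top (Nat.le_add_left 1 n)] at hxs ⊢
    rw [← hxn] at hxs
    have h1 := mul_le_mul_of_nonneg_left (hγ (n + 1) (by omega) le_rfl u) ha
    have h2 := mul_le_mul_of_nonneg_left (hγ (n + 1) (by omega) le_rfl (x n)) hA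
    have h3 := congrArg (fun z => ⟪γ (n + 1), z⟫) hxs
    simp only [inner_add_right, real_inner_smul_right] at h3
    simp only [inner_sub_right] at h1 h2 ih ⊢
    linarith

/-- A sub-Gaussian variable with parameter `K² S` exceeds `2 K √(S log (2 / δ))` with probability
at most `δ`. -/
lemma ProbabilityTheory.HasSubgaussianMGF.measure_lt_le_of_log {Ω : Type*}
    {m0 : MeasurableSpace Ω} {P : Measure Ω} {M : Ω → ℝ} {v : NNReal}
    (hM : HasSubgaussianMGF M v P) {K S δ : ℝ} (hK : 0 ≤ K) (hS : 0 ≤ S)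
    (hv : (v : ℝ) = K ^ 2 * S) (hδ : 0 < δ) (hδ1 : δ ≤ 1) :
    P {ω | 2 * K * Real.sqrt (S * Real.log (2 / δ)) < M ω} ≤ ENNReal.ofReal δ := by
  set ε := 2 * K * Real.sqrt (S * Real.log (2 / δ)) with hε
  have hε0 : 0 ≤ ε := by positivity
  rcases eq_or_ne v 0 with rfl | hv0
  · have h0 : P {ω | ε < M ω} = 0 := by
      refine measure_mono_null (fun ω hω => ?_) (ae_iff.1 hM.ae_eq_zero_of_hasSubgaussianMGF_zero)
      exact (hε0.trans_lt hω).ne'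
    simp [h0]
  have hv1 : (0 : ℝ) < v := by positivity
  have hL : 0 ≤ Real.log (2 / δ) := Real.log_nonneg (by rw [le_div_iff₀ hδ]; linarith)
  have hfin : IsFiniteMeasure P := by
    have h := hM.integrable_exp_mul 0
    simpa [integrable_const_iff, isFiniteMeasure_iff] using h
  rw [← ofReal_measureReal]
  refine ENNReal.ofReal_le_ofReal ?_
  calc P.real {ω | ε < M ω} ≤ P.real {ω | ε ≤ M ω} :=
        measureReal_mono fun ω (hω : ε < M ω) => hω.le
    _ ≤ Real.exp (-ε ^ 2 / (2 * v)) := hM.measure_ge_le hε0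
    _ = Real.exp (-(2 * Real.log (2 / δ))) := by
        congr 1
        rw [div_eq_iff (by positivity), hε, mul_pow, Real.sq_sqrt (mul_nonneg hS hL), hv]
        ring
    _ ≤ Real.exp (-Real.log (2 / δ)) := Real.exp_le_exp.2 (by linarith)
    _ = δ / 2 := by rw [Real.exp_neg, Real.exp_log (by positivity), inv_div]
    _ ≤ δ := by linarith

/-- Theorem 1, high-probability version: with a bounded domain and bounded
gradients, with probability at least `1 − δ`,
`α_{1:T}(ℒ(x_T) − ℒ(x⋆)) ≤ Σ_t α_t ⟨g_t, w_t − x⋆⟩ + 2BG √(Σ_t α_t² log(2/δ))`. -/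
theorem anytime_online_to_batch_high_probability
    {E : Type*} [NormedAddCommGroup E] [InnerProductSpace ℝ E] [CompleteSpace E]
    [SecondCountableTopology E] [MeasurableSpace E] [BorelSpace E]
    {Ω : Type*} [m0 : MeasurableSpace Ω] (P : Measure Ω) [IsProbabilityMeasure P]
    (ℱ : ℕ → MeasurableSpace Ω) (hℱmono : Monotone ℱ) (hℱle : ∀ t, ℱ t ≤ m0)
    (D : Set E) (hD : Convex ℝ D)
    (B : ℝ) (hdiam : ∀ u ∈ D, ∀ v ∈ D, ‖u - v‖ ≤ B)
    (G : ℝ)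
    (T : ℕ) (hT : 1 ≤ T)
    (α : ℕ → ℝ) (hα : ∀ t, 1 ≤ t → t ≤ T → 0 ≤ α t) (hα1 : 0 < α 1)
    (w g : ℕ → Ω → E)
    (hwD : ∀ t, 1 ≤ t → t ≤ T → ∀ ω, w t ω ∈ D)
    (hwmeas : ∀ s t, 1 ≤ s → s ≤ t → t ≤ T → StronglyMeasurable[ℱ t] (w s))
    (hgmeas : ∀ s t, 1 ≤ s → s < t → t ≤ T → StronglyMeasurable[ℱ t] (g s))
    (hgint : ∀ t, 1 ≤ t → t ≤ T → Integrable (g t) P)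
    (hgbound : ∀ t, 1 ≤ t → t ≤ T → ∀ᵐ ω ∂P, ‖g t ω‖ ≤ G)
    (x : ℕ → Ω → E)
    (hx : ∀ t, 1 ≤ t → t ≤ T → ∀ ω,
      x t ω = (∑ i ∈ Finset.Icc 1 t, α i)⁻¹ • ∑ i ∈ Finset.Icc 1 t, α i • w i ω)
    (f : E → ℝ) (hconv : ConvexOn ℝ Set.univ f)
    (hsubgrad : ∀ t, 1 ≤ t → t ≤ T → ∀ᵐ ω ∂P, ∀ y : E,
      f y ≥ f (x t ω) + ⟪(P[g t | ℱ t]) ω, y - x t ω⟫)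
    (xstar : E) (hxstar : xstar ∈ D)
    (δ : ℝ) (hδ : 0 < δ) (hδ1 : δ ≤ 1) :
    ENNReal.ofReal (1 - δ) ≤
      P {ω | (∑ t ∈ Finset.Icc 1 T, α t) * (f (x T ω) - f xstar)
        ≤ (∑ t ∈ Finset.Icc 1 T, α t * ⟪g t ω, w t ω - xstar⟫)
          + 2 * B * G * Real.sqrt ((∑ t ∈ Finset.Icc 1 T, (α t) ^ 2)
              * Real.log (2 / δ))} := by
  have hB : 0 ≤ B := (norm_nonneg _).trans (hdiam xstar hxstar xstar hxstar)
  have hG : 0 ≤ G := by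
    obtain ⟨ω, hω⟩ := (hgbound 1 le_rfl hT).exists
    exact (norm_nonneg _).trans hω
  have hA : ∀ t, 1 ≤ t → t ≤ T → 0 < ∑ i ∈ Finset.Icc 1 t, α i := fun t h1 h2 => by
    refine Finset.sum_pos' (fun i hi => ?_) ⟨1, by simp [h1], hα1⟩
    rw [Finset.mem_Icc] at hi
    exact hα i hi.1 (hi.2.trans h2)
  set Z : ℕ → Ω → ℝ := fun t ω => ⟪g t ω, α t • (w t ω - xstar)⟫
  have hwx : ∀ s t, 1 ≤ s → s ≤ t → t ≤ T →
      StronglyMeasurable[ℱ t] fun ω => α s • (w s ω - xstar) := fun s t h1 h2 h3 =>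
    ((hwmeas s t h1 h2 h3).sub stronglyMeasurable_const).const_smul (α s)
  have hZ : ∀ t, 1 ≤ t → t ≤ T → AEStronglyMeasurable (Z t) P := fun t h1 h2 =>
    (hgint t h1 h2).aestronglyMeasurable.inner
      ((hwx t t h1 le_rfl h2).mono (hℱle t)).aestronglyMeasurable
  have hadapted : ∀ s t, 1 ≤ s → s < t → t ≤ T → StronglyMeasurable[ℱ t] (Z s) :=
    fun s t h1 h2 h3 =>
      (hgmeas s t h1 h2 h3).inner (hwx s t h1 h2.le h3)
  have hZc : ∀ t, 1 ≤ t → t ≤ T → ∀ᵐ ω ∂P, |Z t ω| ≤ (‖B * G * α t‖₊ : ℝ) := by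
    intro t h1 h2
    filter_upwards [hgbound t h1 h2] with ω hω
    have hat := hα t h1 h2
    calc |Z t ω| ≤ ‖g t ω‖ * ‖α t • (w t ω - xstar)‖ := abs_real_inner_le_norm _ _
      _ ≤ G * (α t * B) := by
        rw [norm_smul, Real.norm_of_nonneg hat]
        gcongr
        exact hdiam _ (hwD t h1 h2 ω) _ hxstar
      _ = (‖B * G * α t‖₊ : ℝ) := by
        rw [coe_nnnorm, Real.norm_of_nonneg (by positivity)]; ring
  have hcond : ∀ t, 1 ≤ t → t ≤ T → ∀ᵐ ω ∂P,
      (P[Z t | ℱ t]) ω = α t * ⟪(P[g t | ℱ t]) ω, w t ω - xstar⟫ := by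
    intro t h1 h2
    filter_upwards [condExp_bilin_of_stronglyMeasurable_right (innerSL ℝ) (hwx t t h1 le_rfl h2)
      (Integrable.of_bound (hZ t h1 h2) _ (hZc t h1 h2)) (hgint t h1 h2)] with ω hω
    exact hω.trans (real_inner_smul_right _ _ _)
  set M : Ω → ℝ := fun ω => ∑ t ∈ Finset.Icc 1 T, ((P[Z t | ℱ t]) ω - Z t ω) with hM
  set ε := 2 * B * G * Real.sqrt ((∑ t ∈ Finset.Icc 1 T, (α t) ^ 2) * Real.log (2 / δ))
  have tail : P {ω | ε < M ω} ≤ ENNReal.ofReal δ := by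
    have h := (hasSubgaussianMGF_sum_condExp_sub hℱmono hℱle T hadapted hZ hZc).measure_lt_le_of_log
      (K := B * G) (S := ∑ t ∈ Finset.Icc 1 T, (α t) ^ 2) (by positivity)
      (Finset.sum_nonneg fun _ _ => sq_nonneg _)
      (by
        push_cast
        rw [Finset.mul_sum]
        exact Finset.sum_congr rfl fun t _ => by rw [Real.norm_eq_abs, sq_abs, mul_pow]) hδ hδ1
    rwa [← mul_assoc] at h
  have compl : 1 ≤ P {ω | M ω ≤ ε} + P {ω | ε < M ω} := by
    rw [← measure_univ (μ := P)]
    refine (measure_mono fun ω _ => ?_).trans (measure_union_le _ _)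
    exact le_or_gt (M ω) ε
  have hlow : ENNReal.ofReal (1 - δ) ≤ P {ω | M ω ≤ ε} := by
    rw [ENNReal.ofReal_sub _ hδ.le, ENNReal.ofReal_one, tsub_le_iff_right]
    exact compl.trans (by gcongr)
  refine hlow.trans (measure_mono_ae ?_)
  have hall : ∀ᵐ ω ∂P, ∀ t, 1 ≤ t → t ≤ T →
      (P[Z t | ℱ t]) ω = α t * ⟪(P[g t | ℱ t]) ω, w t ω - xstar⟫ ∧
      ∀ y : E, f y ≥ f (x t ω) + ⟪(P[g t | ℱ t]) ω, y - x t ω⟫ := by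
    simp only [ae_all_iff]
    exact fun t h1 h2 => (hcond t h1 h2).and (hsubgrad t h1 h2)
  filter_upwards [hall] with ω hω (hMω : M ω ≤ ε)
  have hreg := sum_mul_sub_le_sum_mul_inner_of_subgradient (f := f) (w := fun t => w t ω)
    (x := fun t => x t ω) (γ := fun t => (P[g t | ℱ t]) ω) T hα
    (fun t ht => by
      rcases Nat.eq_zero_or_pos t with rfl | h1
      · simp
      · simp only [hx t h1 ht ω, smul_inv_smul₀ (hA t h1 ht).ne'])
    (fun t h1 h2 => (hω t h1 h2).2) xstar
  have hMeq : M ω = (∑ t ∈ Finset.Icc 1 T, α t * ⟪(P[g t | ℱ t]) ω, w t ω - xstar⟫)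
      - ∑ t ∈ Finset.Icc 1 T, α t * ⟪g t ω, w t ω - xstar⟫ := by
    rw [hM, ← Finset.sum_sub_distrib]
    refine Finset.sum_congr rfl fun t ht => ?_
    rw [Finset.mem_Icc] at ht
    rw [(hω t ht.1 ht.2).1]
    simp only [Z, real_inner_smul_right]
  change _ ≤ _
  linarith
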